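/- arXiv:1909.02361 — 2 statements merged into one kernel-verified Lean document; each statement's English description precedes it below -/
import Mathlib

section
/- Let Cone(α) denote the mapping cone of the chain map α. If Cone(α) is homotopy equivalent to the zero complex, then for every integer n the map α_n : λ_n → F_n is injective; indeed there exists an R-linear map ψ_n : F_n → λ_n with ψ_n ∘ α_n = -id_{λ_n}. -/
/-- The differential of the mapping cone of a chain map `α : λ → F` of cochain
complexes, where `λ` has zero differentials.  The degree-`n` term of the cone is
`λ (n+1) × F n` and the differential sends `(a, x)` to `(0, α (n+1) a + d n x)`. -/
def mappingConeD (R : Type*) [CommRing R]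
    (F : ℤ → Type*) [∀ n, AddCommGroup (F n)] [∀ n, Module R (F n)]
    (lam : ℤ → Type*) [∀ n, AddCommGroup (lam n)] [∀ n, Module R (lam n)]
    (d : ∀ n : ℤ, F n →ₗ[R] F (n + 1))
    (α : ∀ n : ℤ, lam n →ₗ[R] F n) (n : ℤ) :
    (lam (n + 1) × F n) →ₗ[R] (lam (n + 1 + 1) × F (n + 1)) :=
  LinearMap.prod 0
    ((α (n + 1)).comp (LinearMap.fst R (lam (n + 1)) (F n)) +
      (d n).comp (LinearMap.snd R (lam (n + 1)) (F n)))

/-- `Cone(α)` is homotopy equivalent to the zero complex: equivalently, the identity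
chain map of the cone is chain homotopic to the zero chain map. -/
def coneNullHomotopic (R : Type*) [CommRing R]
    (F : ℤ → Type*) [∀ n, AddCommGroup (F n)] [∀ n, Module R (F n)]
    (lam : ℤ → Type*) [∀ n, AddCommGroup (lam n)] [∀ n, Module R (lam n)]
    (d : ∀ n : ℤ, F n →ₗ[R] F (n + 1))
    (α : ∀ n : ℤ, lam n →ₗ[R] F n) : Prop :=
  ∃ Ψ : ∀ n : ℤ, (lam (n + 1 + 1) × F (n + 1)) →ₗ[R] (lam (n + 1) × F n),
    ∀ n : ℤ,
      (mappingConeD R F lam d α n).comp (Ψ n) +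
        (Ψ (n + 1)).comp (mappingConeD R F lam d α (n + 1)) = LinearMap.id

/-- If `Cone(α) ∼ 0`, then every `α n` is injective; indeed there is an `R`-linear
map `ψ : F n → λ n` with `ψ ∘ α n = -id`. -/
theorem stmt_0 (R : Type*) [CommRing R]
    (F : ℤ → Type*) [∀ n, AddCommGroup (F n)] [∀ n, Module R (F n)]
    [∀ n, Module.Finite R (F n)] [∀ n, Module.Free R (F n)]
    (d : ∀ n : ℤ, F n →ₗ[R] F (n + 1))
    (hd : ∀ n : ℤ, (d (n + 1)).comp (d n) = 0)
    (G : ∀ n : ℤ, Submodule R (F n))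
    (hG : ∀ n : ℤ, IsCompl (G (n + 1)) (LinearMap.range (d n)))
    (lam : ℤ → Type*) [∀ n, AddCommGroup (lam n)] [∀ n, Module R (lam n)]
    [∀ n, Module.Finite R (lam n)] [∀ n, Module.Free R (lam n)]
    (α : ∀ n : ℤ, lam n →ₗ[R] F n)
    (hchain : ∀ n : ℤ, (d n).comp (α n) = 0)
    (hαG : ∀ n : ℤ, LinearMap.range (α n) ≤ G n)
    (hcone : coneNullHomotopic R F lam d α) :
    ∀ n : ℤ, Function.Injective (α n) ∧
      ∃ ψ : F n →ₗ[R] lam n, ψ.comp (α n) = -LinearMap.id := by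
  intro n
  obtain ⟨m, rfl⟩ : ∃ m : ℤ, n = m + 1 + 1 := ⟨n - 2, by ring⟩
  obtain ⟨Ψ, hΨ⟩ := hcone
  have retract (a : lam (m + 1 + 1)) : (Ψ (m + 1) (0, α (m + 1 + 1) a)).1 = a := by
    simpa [mappingConeD] using congrArg Prod.fst (LinearMap.congr_fun (hΨ m) (a, 0))
  refine ⟨Function.LeftInverse.injective (g := fun x => (Ψ (m + 1) (0, x)).1) retract,
    -(LinearMap.fst R _ _ ∘ₗ Ψ (m + 1) ∘ₗ LinearMap.inr R _ _), ?_⟩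
  ext a
  simp [retract]
end

section
/- The chain map α : λ → F is a homotopy equivalence of cochain complexes if and only if for every integer n the map α_n is injective and the vector space λ_n is isomorphic to the n-th cohomology H^n(F) = ker d_n / Im d_{n-1}. -/
/-- Dependent choice of a family over `ℤ` from a condition on its terms at successors. -/
lemma Int.exists_forall_add_one {T : ℤ → Type*} {R : ∀ m, T (m + 1) → Prop}
    (h : ∀ m, ∃ x, R m x) : ∃ f : ∀ n, T n, ∀ m, R m (f (m + 1)) := by
  choose g hg using h
  have key : ∀ m k (hk : k + 1 = m + 1), R m (hk ▸ g k) := fun m k hk => by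
    obtain rfl : k = m := by omega
    exact hg k
  exact ⟨fun n => (sub_add_cancel n 1) ▸ g (n - 1), fun m => key m _ _⟩

/-- Every linear map `f` between vector spaces has a linear generalized inverse. -/
lemma LinearMap.exists_generalizedInverse {K V W : Type*} [Field K]
    [AddCommGroup V] [Module K V] [AddCommGroup W] [Module K W] (f : V →ₗ[K] W) :
    ∃ h : W →ₗ[K] V, ∀ x, f (h (f x)) = f x := by
  obtain ⟨r, hr⟩ := f.rangeRestrict.exists_rightInverse_of_surjective f.range_rangeRestrict
  obtain ⟨q, hq⟩ := (LinearMap.range f).subtype.exists_leftInverse_of_injective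
    (LinearMap.range f).ker_subtype
  refine ⟨r ∘ₗ q, fun x => ?_⟩
  have h₁ : q (f x) = f.rangeRestrict x := LinearMap.congr_fun hq (f.rangeRestrict x)
  have h₂ := congrArg Subtype.val (LinearMap.congr_fun hr (f.rangeRestrict x))
  simpa [h₁] using h₂

/-- Complementary subspaces admit a projection onto the first one along the second one. -/
lemma IsCompl.exists_projection {K V : Type*} [Field K] [AddCommGroup V] [Module K V]
    {p q : Submodule K V} (h : IsCompl p q) :
    ∃ π : V →ₗ[K] V, (∀ x, π x ∈ p) ∧ (∀ x ∈ p, π x = x) ∧ (∀ x ∈ q, π x = 0) ∧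
      ∀ x, x - π x ∈ q := by
  obtain ⟨π, hp, hq⟩ : ∃ π : V →ₗ[K] p, (∀ x : p, π x = x) ∧ ∀ x, π x = 0 ↔ x ∈ q :=
    ⟨p.projectionOnto q h, Submodule.projectionOnto_apply_left h,
      fun _ => Submodule.projectionOnto_apply_eq_zero_iff h⟩
  refine ⟨p.subtype ∘ₗ π, fun x => (π x).2, fun x hx => ?_, fun x hx => ?_, fun x => ?_⟩
  · simp [hp ⟨x, hx⟩]
  · simp [(hq x).2 hx]
  · simp [← hq, hp]

/-- If `a` is injective with values in `ker g ∩ G`, where `G` is a complement of `im f`, and its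
source has the dimension of `ker g / im f`, then its range is `ker g ∩ G`. -/
lemma LinearMap.mem_range_of_equiv_homology {K L V W X : Type*} [Field K]
    [AddCommGroup L] [Module K L] [AddCommGroup V] [Module K V] [AddCommGroup W] [Module K W]
    [AddCommGroup X] [Module K X] [FiniteDimensional K L] [FiniteDimensional K W]
    {f : V →ₗ[K] W} {g : W →ₗ[K] X} {a : L →ₗ[K] W} {G : Submodule K W}
    (hG : Disjoint G (LinearMap.range f)) (ha : Function.Injective a)
    (hga : g.comp a = 0) (haG : LinearMap.range a ≤ G)
    (e : L ≃ₗ[K] (LinearMap.ker g ⧸ (LinearMap.range f).comap (LinearMap.ker g).subtype))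
    {w : W} (hw : w ∈ G) (hgw : g w = 0) : w ∈ LinearMap.range a := by
  let φ := ((LinearMap.range f).comap (LinearMap.ker g).subtype).mkQ ∘ₗ
    a.codRestrict (LinearMap.ker g) (fun l => LinearMap.congr_fun hga l)
  have hφ : Function.Injective φ := by
    rw [injective_iff_map_eq_zero]
    intro l hl
    have hl' : a l ∈ LinearMap.range f :=
      (Submodule.Quotient.mk_eq_zero
        ((LinearMap.range f).comap (LinearMap.ker g).subtype)).1 hl
    exact (injective_iff_map_eq_zero a).1 ha l
      (Submodule.disjoint_def.1 hG _ (haG ⟨l, rfl⟩) hl')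
  obtain ⟨l, hl⟩ := (LinearMap.injective_iff_surjective_of_finrank_eq_finrank
    e.finrank_eq).1 hφ (Submodule.Quotient.mk ⟨w, hgw⟩)
  have hlw : a l - w ∈ LinearMap.range f :=
    (Submodule.Quotient.eq ((LinearMap.range f).comap (LinearMap.ker g).subtype)).1 hl
  exact ⟨l, sub_eq_zero.1
    (Submodule.disjoint_def.1 hG _ (G.sub_mem (haG ⟨l, rfl⟩) hw) hlw)⟩

/-- A left inverse `b` of `a` with `b ∘ f = 0`, such that cycles killed by `b` are boundaries,
identifies the homology `ker g / im f` with the source of `a`. -/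
lemma LinearMap.nonempty_equiv_homology {K L V W X : Type*} [Field K]
    [AddCommGroup L] [Module K L] [AddCommGroup V] [Module K V] [AddCommGroup W] [Module K W]
    [AddCommGroup X] [Module K X]
    {f : V →ₗ[K] W} {g : W →ₗ[K] X} {a : L →ₗ[K] W} {b : W →ₗ[K] L}
    (hga : g.comp a = 0) (hbf : b.comp f = 0) (hba : ∀ l, b (a l) = l)
    (hb : ∀ w, g w = 0 → b w = 0 → w ∈ LinearMap.range f) :
    Nonempty (L ≃ₗ[K]
      (LinearMap.ker g ⧸ (LinearMap.range f).comap (LinearMap.ker g).subtype)) := by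
  have hker : (LinearMap.range f).comap (LinearMap.ker g).subtype =
      LinearMap.ker (b ∘ₗ (LinearMap.ker g).subtype) := by
    ext ⟨w, hw⟩
    refine ⟨?_, fun h => hb w hw h⟩
    rintro ⟨v, rfl⟩
    exact LinearMap.congr_fun hbf v
  rw [hker]
  exact ⟨(LinearMap.quotKerEquivOfSurjective _
    fun l => ⟨⟨a l, LinearMap.congr_fun hga l⟩, hba l⟩).symm⟩


/-- The chain map `α : λ → F` is a homotopy equivalence of cochain complexes
(i.e. it admits a chain-map inverse `β` up to chain homotopy in both directions;
the differentials of `λ` are zero, which is why the homotopy equations on the `λ`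
side involve the zero maps) if and only if every `α n` is injective and every
`λ n` is isomorphic to `H^n(F) = ker d_n / Im d_{n-1}` (conditions involving
degree-shifted indices are stated at degree `n + 1`, which ranges over all
integers). -/
theorem stmt_8 (K : Type*) [Field K]
    (F : ℤ → Type*) [∀ n, AddCommGroup (F n)] [∀ n, Module K (F n)]
    [∀ n, FiniteDimensional K (F n)]
    (d : ∀ n : ℤ, F n →ₗ[K] F (n + 1))
    (hd : ∀ n : ℤ, (d (n + 1)).comp (d n) = 0)
    (G : ∀ n : ℤ, Submodule K (F n))
    (hG : ∀ n : ℤ, IsCompl (G (n + 1)) (LinearMap.range (d n)))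
    (lam : ℤ → Type*) [∀ n, AddCommGroup (lam n)] [∀ n, Module K (lam n)]
    [∀ n, FiniteDimensional K (lam n)]
    (α : ∀ n : ℤ, lam n →ₗ[K] F n)
    (hchain : ∀ n : ℤ, (d n).comp (α n) = 0)
    (hαG : ∀ n : ℤ, LinearMap.range (α n) ≤ G n) :
    (∃ β : ∀ n : ℤ, F n →ₗ[K] lam n,
      -- `β` is a chain map `F → λ` (the differentials of `λ` are zero)
      (∀ n : ℤ, (β (n + 1)).comp (d n) = 0) ∧
      -- `β ∘ α` is chain homotopic to the identity of `λ`
      (∃ Ψ : ∀ n : ℤ, lam (n + 1) →ₗ[K] lam n,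
        ∀ n : ℤ, LinearMap.id - (β (n + 1)).comp (α (n + 1)) =
          ((0 : lam n →ₗ[K] lam (n + 1)).comp (Ψ n)) +
            ((Ψ (n + 1)).comp (0 : lam (n + 1) →ₗ[K] lam (n + 1 + 1)))) ∧
      -- `α ∘ β` is chain homotopic to the identity of `F`
      (∃ Φ : ∀ n : ℤ, F (n + 1) →ₗ[K] F n,
        ∀ n : ℤ, LinearMap.id - (α (n + 1)).comp (β (n + 1)) =
          (d n).comp (Φ n) + (Φ (n + 1)).comp (d (n + 1)))) ↔
    ((∀ n : ℤ, Function.Injective (α n)) ∧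
      ∀ n : ℤ, Nonempty
        (lam (n + 1) ≃ₗ[K]
          (↥(LinearMap.ker (d (n + 1))) ⧸
            (LinearMap.range (d n)).comap (LinearMap.ker (d (n + 1))).subtype))) := by
  have hsucc : ∀ n : ℤ, ∃ m, n = m + 1 := fun n => ⟨n - 1, by omega⟩
  constructor
  · rintro ⟨β, hβd, ⟨Ψ, hΨ⟩, Φ, hΦ⟩
    have hβα : ∀ n l, β (n + 1) (α (n + 1) l) = l := fun n l => by
      have := LinearMap.congr_fun (hΨ n) l
      simp [sub_eq_zero] at this
      exact this.symm
    refine ⟨fun n => ?_, fun n => ?_⟩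
    · obtain ⟨m, rfl⟩ := hsucc n
      exact Function.LeftInverse.injective (hβα m)
    · refine LinearMap.nonempty_equiv_homology (hchain (n + 1)) (hβd n) (hβα n)
        fun w hdw hβw => ⟨Φ n w, ?_⟩
      have := LinearMap.congr_fun (hΦ n) w
      simpa [hdw, hβw] using this.symm
  · rintro ⟨hinj, hiso⟩
    obtain ⟨p, hp⟩ := Int.exists_forall_add_one (T := fun n => F n →ₗ[K] F n)
      (R := fun m π => (∀ x, π x ∈ G (m + 1)) ∧ (∀ x ∈ G (m + 1), π x = x) ∧
        (∀ x ∈ LinearMap.range (d m), π x = 0) ∧ ∀ x, x - π x ∈ LinearMap.range (d m))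
      fun m => (hG m).exists_projection
    have hpG : ∀ n x, p n x ∈ G n := fun n => by
      obtain ⟨m, rfl⟩ := hsucc n
      exact (hp m).1
    have hpid : ∀ n, ∀ x ∈ G n, p n x = x := fun n => by
      obtain ⟨m, rfl⟩ := hsucc n
      exact (hp m).2.1
    have hpd : ∀ n x, p (n + 1) (d n x) = 0 := fun n x => (hp n).2.2.1 _ ⟨x, rfl⟩
    have hdd : ∀ n x, d (n + 1) (d n x) = 0 := fun n => LinearMap.congr_fun (hd n)
    have hdp : ∀ n x, d n (p n x) = d n x := fun n x => by
      obtain ⟨m, rfl⟩ := hsucc n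
      obtain ⟨y, hy⟩ := (hp m).2.2.2 x
      have := hdd m y
      rw [hy, map_sub, sub_eq_zero] at this
      exact this.symm
    have hdα : ∀ n l, d n (α n l) = 0 := fun n => LinearMap.congr_fun (hchain n)
    have hcycle : ∀ n, ∀ w ∈ G n, d n w = 0 → w ∈ LinearMap.range (α n) := fun n w hw hdw => by
      obtain ⟨m, rfl⟩ := hsucc n
      exact LinearMap.mem_range_of_equiv_homology (hG m).disjoint (hinj _) (hchain _) (hαG _)
        (hiso m).some hw hdw
    choose g hg using fun n =>
      (α n).exists_leftInverse_of_injective (LinearMap.ker_eq_bot.2 (hinj n))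
    choose h hh using fun n => (d n).exists_generalizedInverse
    have hgα : ∀ n l, g n (α n l) = l := fun n => LinearMap.congr_fun (hg n)
    have hpα : ∀ n l, p n (α n l) = α n l := fun n l => hpid n _ (hαG n ⟨l, rfl⟩)
    -- the homotopy inverts `d n` on the complement of `im (α n)` in `G n` cut out by `g n`
    refine ⟨fun n => g n ∘ₗ p n, fun n => ?_, ⟨0, fun n => ?_⟩,
      ⟨fun n => (LinearMap.id - α n ∘ₗ g n) ∘ₗ p n ∘ₗ h n ∘ₗ (LinearMap.id - p (n + 1)),
        fun n => ?_⟩⟩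
    · ext x
      simp [hpd]
    · ext l
      simp [hpα, hgα]
    · ext x
      obtain ⟨y, hy⟩ := (hp n).2.2.2 x
      obtain ⟨l, hl⟩ := hcycle (n + 1) (p (n + 1) (h (n + 1) (d (n + 1) x) - x)) (hpG _ _)
        (by rw [hdp, map_sub, hh, sub_self])
      have hhd : p (n + 1) (h (n + 1) (d (n + 1) x)) = p (n + 1) x + α (n + 1) l := by
        rw [hl, map_sub]
        abel
      have hdh : d n (h n (x - p (n + 1) x)) = x - p (n + 1) x := by
        rw [← hy, hh]
      simp only [LinearMap.sub_apply, LinearMap.add_apply, LinearMap.comp_apply,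
        LinearMap.id_apply, hpd, sub_zero, hhd, map_add, hgα]
      rw [map_sub (d n), hdα, hdp, hdh]
      abel
end
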